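/- arXiv:1205.6655 — 9 statements merged into one kernel-verified Lean document; each statement's English description precedes it below -/
import Mathlib

section
/- Let k ≥ 1 and let d = (d_1,…,d_k) and e = (e_1,…,e_{k+1}) be non-decreasing sequences of positive integers with d_1 ≥ 2, satisfying conditions (C1), (C2), (C3). Then at least one of the following holds: (a) S(d;e) = 0; or (b) S(d;e) ≥ S(d;1^{k+1}) = Σ_{1≤i≤j≤k} (d_i−1)(d_j−1); or (c) S(d;e) = 2^{k−1}, k ∈ {2,3,4}, e_1 = e_2 = 1, and d_1 = … = d_k = e_3 = … = e_{k+1} = 2. -/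
/-- `S(d;e) = e_1⋯e_{k+1} · Σ_{1≤i≤j≤k} (d_i − e_i)(d_j − e_{j+1})` for 1-based
sequences `d` of length `k` and `e` of length `k+1`. -/
def Sde (k : ℕ) (d e : ℕ → ℤ) : ℤ :=
  (∏ j ∈ Finset.Icc 1 (k + 1), e j) *
    ∑ i ∈ Finset.Icc 1 k, ∑ j ∈ Finset.Icc i k, (d i - e i) * (d j - e (j + 1))

/-- `(d_1,…,d_len)` is obtained from `(e_1,…,e_{len+1})` by deleting one entry. -/
def DelOne (d e : ℕ → ℤ) (len : ℕ) : Prop :=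
  ∃ m, 1 ≤ m ∧ m ≤ len + 1 ∧ ∀ j, 1 ≤ j → j ≤ len → d j = if j < m then e j else e (j + 1)

/-- Condition (C1): `d_i ≥ e_i` for `1 ≤ i ≤ k`. -/
def CondOne (k : ℕ) (d e : ℕ → ℤ) : Prop := ∀ i, 1 ≤ i → i ≤ k → e i ≤ d i

/-- Condition (C2): for `1 ≤ i ≤ k`, if `d_i < e_{i+1}` then `(d_1,…,d_i) = (e_1,…,e_i)`. -/
def CondTwo (k : ℕ) (d e : ℕ → ℤ) : Prop :=
  ∀ i, 1 ≤ i → i ≤ k → d i < e (i + 1) → ∀ j, 1 ≤ j → j ≤ i → d j = e j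

/-- Condition (C3): for `1 ≤ i ≤ k−1`, if `d_i < e_{i+2}` then `(d_1,…,d_i)` is a
subsequence of `(e_1,…,e_{i+1})` (obtained by deleting one entry). -/
def CondThree (k : ℕ) (d e : ℕ → ℤ) : Prop :=
  ∀ i, 1 ≤ i → i ≤ k - 1 → d i < e (i + 2) → DelOne d e i

open Finset

/-- The triangular double sum `Σ_{1≤i≤j≤n} x_i y_j`. -/
def triSum (x y : ℕ → ℤ) (n : ℕ) : ℤ :=
  ∑ i ∈ Icc 1 n, ∑ j ∈ Icc i n, x i * y j

theorem triSum_zero (x y : ℕ → ℤ) : triSum x y 0 = 0 := by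
  simp [triSum]

theorem triSum_succ (x y : ℕ → ℤ) (n : ℕ) :
    triSum x y (n + 1) = triSum x y n + (∑ i ∈ Icc 1 (n + 1), x i) * y (n + 1) := by
  have h : ∀ i ∈ Icc 1 (n + 1), ∑ j ∈ Icc i (n + 1), x i * y j
      = ∑ j ∈ Icc i n, x i * y j + x i * y (n + 1) := fun i hi =>
    sum_Icc_succ_top (mem_Icc.mp hi).2 _
  unfold triSum
  rw [sum_congr rfl h, sum_add_distrib, sum_mul, sum_Icc_succ_top (by omega)]
  simp

theorem triSum_nonneg {x y : ℕ → ℤ} {n : ℕ} (hx : ∀ i, 1 ≤ i → i ≤ n → 0 ≤ x i)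
    (hy : ∀ i, 1 ≤ i → i ≤ n → 0 ≤ y i) : 0 ≤ triSum x y n := by
  refine sum_nonneg fun i hi => sum_nonneg fun j hj => ?_
  rw [mem_Icc] at hi hj
  exact mul_nonneg (hx i hi.1 hi.2) (hy j (by omega) hj.2)

theorem Sde_eq_triSum (k : ℕ) (d e : ℕ → ℤ) :
    Sde k d e = (∏ j ∈ Icc 1 (k + 1), e j) *
      triSum (fun i => d i - e i) (fun j => d j - e (j + 1)) k := rfl

theorem Sde_one (k : ℕ) (d : ℕ → ℤ) :
    Sde k d (fun _ => 1) = triSum (fun i => d i - 1) (fun i => d i - 1) k := by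
  simp [Sde_eq_triSum]

theorem Sde_succ (n : ℕ) (d e : ℕ → ℤ) :
    Sde (n + 1) d e = e (n + 2) * (Sde n d e + (∏ j ∈ Icc 1 (n + 1), e j) *
      (∑ i ∈ Icc 1 (n + 1), (d i - e i)) * (d (n + 1) - e (n + 2))) := by
  rw [Sde_eq_triSum, Sde_eq_triSum, triSum_succ, prod_Icc_succ_top (by omega : 1 ≤ n + 1 + 1)]
  ring

theorem Sde_eq_zero_of_delOne {n : ℕ} {d e : ℕ → ℤ} (h : DelOne d e n) : Sde n d e = 0 := by
  obtain ⟨m, -, -, hm⟩ := h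
  rw [Sde_eq_triSum]
  refine mul_eq_zero_of_right _ (sum_eq_zero fun i hi => sum_eq_zero fun j hj => ?_)
  rw [mem_Icc] at hi hj
  have h1 := hm i hi.1 hi.2
  have h2 := hm j (by omega) hj.2
  rcases lt_or_ge i m with him | him
  · simp [h1, him]
  · have hjm : ¬ j < m := by omega
    simp [h2, hjm]

theorem delOne_of_forall_eq {n : ℕ} {d e : ℕ → ℤ} (h : ∀ j, 1 ≤ j → j ≤ n → d j = e j) :
    DelOne d e n :=
  ⟨n + 1, by omega, le_rfl, fun j h1 h2 => by rw [if_pos (by omega), h j h1 h2]⟩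

theorem DelOne.succ {n : ℕ} {d e : ℕ → ℤ} (h : DelOne d e n) (hn : d (n + 1) = e (n + 2)) :
    DelOne d e (n + 1) := by
  obtain ⟨m, hm1, hm2, hm⟩ := h
  refine ⟨m, hm1, by omega, fun j h1 h2 => ?_⟩
  rcases Nat.lt_or_ge n j with hj | hj
  · obtain rfl : j = n + 1 := by omega
    rw [if_neg (by omega), hn]
  · exact hm j h1 hj

theorem prod_Icc_insert {M : Type*} [CommMonoid M] {d e : ℕ → M} {m : ℕ} (n : ℕ) (hm1 : 1 ≤ m)
    (hm2 : m ≤ n + 1) (h : ∀ j, 1 ≤ j → j ≤ n → d j = if j < m then e j else e (j + 1)) :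
    ∏ j ∈ Icc 1 (n + 1), e j = (∏ j ∈ Icc 1 n, d j) * e m := by
  induction n with
  | zero =>
    obtain rfl : m = 1 := by omega
    simp
  | succ n ih =>
    rw [prod_Icc_succ_top (by omega)]
    rcases Nat.lt_or_ge (n + 1) m with hm | hm
    · obtain rfl : m = n + 1 + 1 := by omega
      congr 1
      refine prod_congr rfl fun j hj => ?_
      rw [mem_Icc] at hj
      rw [h j hj.1 hj.2, if_pos (by omega)]
    · rw [ih hm fun j h1 h2 => h j h1 (by omega), prod_Icc_succ_top (by omega),
        h (n + 1) (by omega) le_rfl, if_neg (by omega)]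
      exact mul_right_comm _ _ _

theorem sum_Icc_insert {M : Type*} [AddCommMonoid M] {d e : ℕ → M} {m : ℕ} (n : ℕ) (hm1 : 1 ≤ m)
    (hm2 : m ≤ n + 1) (h : ∀ j, 1 ≤ j → j ≤ n → d j = if j < m then e j else e (j + 1)) :
    ∑ j ∈ Icc 1 (n + 1), e j = (∑ j ∈ Icc 1 n, d j) + e m :=
  prod_Icc_insert (M := Multiplicative M) n hm1 hm2 h

theorem sub_one_le_mul_sub {w d : ℤ} (h1 : 1 ≤ w) (h2 : w < d) : d - 1 ≤ w * (d - w) := by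
  nlinarith

theorem sum_sub_one_lt_prod {d : ℕ → ℤ} (n : ℕ) (hd : ∀ i, 1 ≤ i → i ≤ n → 1 ≤ d i) :
    1 + ∑ i ∈ Icc 1 n, (d i - 1) ≤ ∏ i ∈ Icc 1 n, d i := by
  induction n with
  | zero => simp
  | succ n ih =>
    have h := ih fun i h1 h2 => hd i h1 (by omega)
    have h1 := hd (n + 1) (by omega) le_rfl
    have h0 : 0 ≤ ∑ i ∈ Icc 1 n, (d i - 1) := sum_nonneg fun i hi => by
      rw [mem_Icc] at hi
      linarith [hd i hi.1 (by omega)]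
    rw [sum_Icc_succ_top (by omega), prod_Icc_succ_top (by omega)]
    nlinarith

theorem sum_sub_one_le_prod_mul_sum {d e : ℕ → ℤ} (n : ℕ) (he : ∀ i, 1 ≤ i → i ≤ n → 1 ≤ e i)
    (hde : ∀ i, 1 ≤ i → i ≤ n → e i ≤ d i) (hpos : 0 < ∑ i ∈ Icc 1 n, (d i - e i)) :
    ∑ i ∈ Icc 1 n, (d i - 1) ≤ (∏ i ∈ Icc 1 n, e i) * ∑ i ∈ Icc 1 n, (d i - e i) := by
  induction n with
  | zero => simp
  | succ n ih =>
    have ih := ih (fun i h1 h2 => he i h1 (by omega)) (fun i h1 h2 => hde i h1 (by omega))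
    have hnn : 0 ≤ ∑ i ∈ Icc 1 n, (d i - e i) := sum_nonneg fun i hi => by
      rw [mem_Icc] at hi
      linarith [hde i hi.1 (by omega)]
    have hP := sum_sub_one_lt_prod n (d := e) fun i h1 h2 => he i h1 (by omega)
    have hA : 0 ≤ ∑ i ∈ Icc 1 n, (e i - 1) := sum_nonneg fun i hi => by
      rw [mem_Icc] at hi
      linarith [he i hi.1 (by omega)]
    have he1 := he (n + 1) (by omega) le_rfl
    have hde1 := hde (n + 1) (by omega) le_rfl
    rw [sum_Icc_succ_top (by omega)] at hpos ⊢
    rw [sum_Icc_succ_top (by omega), prod_Icc_succ_top (by omega)]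
    rcases hnn.eq_or_lt with h0 | h0
    · have hsum : ∑ i ∈ Icc 1 n, (d i - 1) = ∑ i ∈ Icc 1 n, (e i - 1) := by
        have : ∑ i ∈ Icc 1 n, (d i - 1) =
            ∑ i ∈ Icc 1 n, (d i - e i) + ∑ i ∈ Icc 1 n, (e i - 1) := by
          rw [← sum_add_distrib]
          exact sum_congr rfl fun i _ => by ring
        rw [this, ← h0, zero_add]
      have hlt : e (n + 1) < d (n + 1) := by linarith
      have hw := sub_one_le_mul_sub he1 hlt
      rw [← h0, hsum]
      generalize ∑ i ∈ Icc 1 n, (e i - 1) = A at *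
      generalize ∏ i ∈ Icc 1 n, e i = P at *
      have : P * (d (n + 1) - 1) ≤ P * (e (n + 1) * (d (n + 1) - e (n + 1))) :=
        mul_le_mul_of_nonneg_left hw (by linarith)
      nlinarith
    · have ih := ih h0
      generalize ∑ i ∈ Icc 1 n, (d i - 1) = D at *
      generalize ∑ i ∈ Icc 1 n, (e i - 1) = A at *
      generalize ∏ i ∈ Icc 1 n, e i = P at *
      generalize ∑ i ∈ Icc 1 n, (d i - e i) = U at *
      have hPU : 1 ≤ P * U := by nlinarith
      rcases hde1.eq_or_lt with heq | hlt
      · rw [← heq]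
        nlinarith
      · have hw := sub_one_le_mul_sub he1 hlt
        have h1 : P * U ≤ e (n + 1) * (P * U) := by nlinarith
        have h2 : e (n + 1) * (d (n + 1) - e (n + 1)) ≤
            P * (e (n + 1) * (d (n + 1) - e (n + 1))) :=
          le_mul_of_one_le_left (by nlinarith) (by linarith)
        nlinarith

theorem triSum_add_le_prod_mul_sq {d : ℕ → ℤ} {b : ℤ} (n : ℕ) (hb : 1 ≤ b)
    (hd : ∀ i, 1 ≤ i → i ≤ n → 1 ≤ d i) (hdb : ∀ i, 1 ≤ i → i ≤ n → d i ≤ b) :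
    triSum (fun i => d i - 1) (fun i => d i - 1) n + b * (∑ i ∈ Icc 1 n, (d i - 1) + b) ≤
      (∏ i ∈ Icc 1 n, d i) * (b * b) := by
  induction n with
  | zero => simp [triSum_zero]
  | succ n ih =>
    have ih := ih (fun i h1 h2 => hd i h1 (by omega)) (fun i h1 h2 => hdb i h1 (by omega))
    have hT : 0 ≤ triSum (fun i => d i - 1) (fun i => d i - 1) n :=
      triSum_nonneg (fun i h1 h2 => by linarith [hd i h1 (by omega)])
        (fun i h1 h2 => by linarith [hd i h1 (by omega)])
    have hA : 0 ≤ ∑ i ∈ Icc 1 n, (d i - 1) := sum_nonneg fun i hi => by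
      rw [mem_Icc] at hi
      linarith [hd i hi.1 (by omega)]
    have h1 := hd (n + 1) (by omega) le_rfl
    have h2 := hdb (n + 1) (by omega) le_rfl
    rw [triSum_succ, sum_Icc_succ_top (by omega), prod_Icc_succ_top (by omega)]
    generalize triSum (fun i => d i - 1) (fun i => d i - 1) n = T at *
    generalize ∑ i ∈ Icc 1 n, (d i - 1) = A at *
    generalize ∏ i ∈ Icc 1 n, d i = P at *
    obtain ⟨a, ha⟩ : ∃ a, d (n + 1) = a + 1 := ⟨d (n + 1) - 1, by ring⟩
    rw [ha] at h1 h2 ⊢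
    have ha0 : 0 ≤ a := by linarith
    have key : 0 ≤ a * (b * b - b - a + (b - 1) * A + T) := by
      refine mul_nonneg ha0 ?_
      have : 0 ≤ (b - 1) * A := mul_nonneg (by linarith) hA
      nlinarith
    have := mul_le_mul_of_nonneg_left ih (by linarith : 0 ≤ a + 1)
    nlinarith

theorem sum_add_le_triSum {a : ℕ → ℤ} (n : ℕ) (ha : ∀ i, 1 ≤ i → i ≤ n + 2 → 1 ≤ a i) :
    ∑ i ∈ Icc 1 (n + 2), a i + a (n + 2) ≤ triSum a a (n + 2) := by
  have hA : 0 ≤ ∑ i ∈ Icc 1 n, a i := sum_nonneg fun i hi => by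
    rw [mem_Icc] at hi
    linarith [ha i hi.1 (by omega)]
  have hT : 0 ≤ triSum a a n :=
    triSum_nonneg (fun i h1 h2 => by linarith [ha i h1 (by omega)])
      (fun i h1 h2 => by linarith [ha i h1 (by omega)])
  have hx := ha (n + 1) (by omega) (by omega)
  have hy := ha (n + 2) (by omega) (by omega)
  rw [triSum_succ, triSum_succ, sum_Icc_succ_top (by omega), sum_Icc_succ_top (by omega)]
  simp only [add_assoc, one_add_one_eq_two] at *
  nlinarith [mul_nonneg hA (sub_nonneg.mpr hx), mul_nonneg hA (sub_nonneg.mpr hy),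
    mul_nonneg (sub_nonneg.mpr hx) (sub_nonneg.mpr hy), mul_self_nonneg (a (n + 2) - 1),
    mul_self_nonneg (a (n + 1) - 1)]

/-- The exceptional pairs: `d = 2^n` and `e = (1, 1, 2, …, 2)`. -/
def IsExceptional (n : ℕ) (d e : ℕ → ℤ) : Prop :=
  Sde n d e = 2 ^ (n - 1) ∧ (n = 2 ∨ n = 3 ∨ n = 4) ∧ e 1 = 1 ∧ e 2 = 1 ∧
    (∀ i, 1 ≤ i → i ≤ n → d i = 2) ∧ (∀ j, 3 ≤ j → j ≤ n + 1 → e j = 2)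

theorem Sde_one_succ (n : ℕ) (d : ℕ → ℤ) :
    Sde (n + 1) d (fun _ => 1) = Sde n d (fun _ => 1) +
      (∑ i ∈ Icc 1 n, (d i - 1) + (d (n + 1) - 1)) * (d (n + 1) - 1) := by
  rw [Sde_one, Sde_one, triSum_succ, sum_Icc_succ_top (by omega)]

theorem Sde_succ_of_eq {n : ℕ} {d e : ℕ → ℤ} (h : d (n + 1) = e (n + 2)) :
    Sde (n + 1) d e = d (n + 1) * Sde n d e := by
  rw [Sde_succ, h]
  ring

theorem Sde_one_le_of_delOne {n : ℕ} {d e : ℕ → ℤ}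
    (hd : ∀ i, 1 ≤ i → i ≤ n → 1 ≤ d i) (he : ∀ i, 1 ≤ i → i ≤ n + 2 → 1 ≤ e i)
    (hdmono : ∀ i, 1 ≤ i → i ≤ n → d i ≤ d n)
    (hemono : ∀ i j, 1 ≤ i → i ≤ j → j ≤ n + 2 → e i ≤ e j)
    (hv : e (n + 2) < d (n + 1)) (hU : 0 < ∑ i ∈ Icc 1 (n + 1), (d i - e i))
    (h : DelOne d e n) :
    Sde (n + 1) d (fun _ => 1) ≤ Sde (n + 1) d e := by
  have hS := Sde_eq_zero_of_delOne h
  obtain ⟨m, hm1, hm2, hm⟩ := h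
  have hUm : ∑ i ∈ Icc 1 (n + 1), (d i - e i) = d (n + 1) - e m := by
    rw [sum_sub_distrib, sum_Icc_insert n hm1 hm2 hm, sum_Icc_succ_top (by omega)]
    ring
  rw [hUm] at hU
  have hem := he m hm1 (by omega)
  have hw := he (n + 2) (by omega) le_rfl
  have hdb : ∀ i, 1 ≤ i → i ≤ n → d i ≤ d (n + 1) - 1 := by
    intro i h1 h2
    have hle : d n ≤ e (n + 2) := by
      rw [hm n (by omega) le_rfl]
      split_ifs
      · exact hemono _ _ (by omega) (by omega) le_rfl
      · exact hemono _ _ (by omega) (by omega) le_rfl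
    linarith [hdmono i h1 h2]
  have key := triSum_add_le_prod_mul_sq n (b := d (n + 1) - 1) (by linarith) hd hdb
  have hP := sum_sub_one_lt_prod n hd
  have hA : 0 ≤ ∑ i ∈ Icc 1 n, (d i - 1) := sum_nonneg fun i hi => by
    rw [mem_Icc] at hi
    linarith [hd i hi.1 hi.2]
  rw [Sde_succ n d e, hS, hUm, prod_Icc_insert n hm1 hm2 hm, Sde_one_succ, Sde_one]
  have h1 := sub_one_le_mul_sub hem (by linarith : e m < d (n + 1))
  have h2 := sub_one_le_mul_sub hw hv
  have h3 := mul_le_mul h1 h2 (by linarith) (by nlinarith)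
  have h4 := mul_le_mul_of_nonneg_left h3 (by linarith : 0 ≤ ∏ i ∈ Icc 1 n, d i)
  linarith

theorem Sde_one_le_of_isExceptional {n : ℕ} {d e : ℕ → ℤ}
    (hw : e (n + 1) ≤ e (n + 2)) (hv : e (n + 2) < d (n + 1))
    (h : IsExceptional n d e) :
    Sde (n + 1) d (fun _ => 1) ≤ Sde (n + 1) d e := by
  obtain ⟨hS, hn, he1, he2, hd, he⟩ := h
  have hw2 : 2 ≤ e (n + 2) := by rw [← he (n + 1) (by omega) le_rfl]; exact hw
  have h1 := sub_one_le_mul_sub (by linarith : 1 ≤ e (n + 2)) hv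
  rw [Sde_succ n d e, hS, Sde_one]
  rcases hn with rfl | rfl | rfl
  · have := hd 1 (by omega) (by omega)
    have := hd 2 (by omega) (by omega)
    have := he 3 (by omega) (by omega)
    simp_all [triSum_succ, triSum_zero, prod_Icc_succ_top, sum_Icc_succ_top]
    nlinarith
  · have := hd 1 (by omega) (by omega)
    have := hd 2 (by omega) (by omega)
    have := hd 3 (by omega) (by omega)
    have := he 3 (by omega) (by omega)
    have := he 4 (by omega) (by omega)
    simp_all [triSum_succ, triSum_zero, prod_Icc_succ_top, sum_Icc_succ_top]
    nlinarith
  · have := hd 1 (by omega) (by omega)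
    have := hd 2 (by omega) (by omega)
    have := hd 3 (by omega) (by omega)
    have := hd 4 (by omega) (by omega)
    have := he 3 (by omega) (by omega)
    have := he 4 (by omega) (by omega)
    have := he 5 (by omega) (by omega)
    simp_all [triSum_succ, triSum_zero, prod_Icc_succ_top, sum_Icc_succ_top]
    nlinarith

theorem Sde_one_le_of_lt {n : ℕ} {d e : ℕ → ℤ}
    (hd : ∀ i, 1 ≤ i → i ≤ n + 1 → 1 ≤ d i) (he : ∀ i, 1 ≤ i → i ≤ n + 2 → 1 ≤ e i)
    (hde : ∀ i, 1 ≤ i → i ≤ n + 1 → e i ≤ d i)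
    (hv : e (n + 2) < d (n + 1)) (hU : 0 < ∑ i ∈ Icc 1 (n + 1), (d i - e i))
    (h : Sde n d (fun _ => 1) ≤ Sde n d e) :
    Sde (n + 1) d (fun _ => 1) ≤ Sde (n + 1) d e := by
  have hT : 0 ≤ Sde n d (fun _ => 1) := by
    rw [Sde_one]
    exact triSum_nonneg (fun i h1 h2 => by linarith [hd i h1 (by omega)])
      (fun i h1 h2 => by linarith [hd i h1 (by omega)])
  have hA : 0 ≤ ∑ i ∈ Icc 1 (n + 1), (d i - 1) := sum_nonneg fun i hi => by
    rw [mem_Icc] at hi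
    linarith [hd i hi.1 hi.2]
  have key := sum_sub_one_le_prod_mul_sum (n + 1) (fun i h1 h2 => he i h1 (by omega)) hde hU
  have hw := he (n + 2) (by omega) le_rfl
  have h1 := sub_one_le_mul_sub hw hv
  have h2 := mul_le_mul key h1 (by linarith) (by linarith)
  rw [Sde_succ n d e, Sde_one_succ, ← sum_Icc_succ_top (by omega) fun i => d i - 1]
  nlinarith

theorem Sde_one_le_or_isExceptional_of_eq {n : ℕ} {d e : ℕ → ℤ} (hn : 1 ≤ n)
    (hd : ∀ i, 1 ≤ i → i ≤ n + 1 → 2 ≤ d i) (he : ∀ i, 1 ≤ i → i ≤ n + 2 → 1 ≤ e i)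
    (hemono : e (n + 1) ≤ e (n + 2)) (hde : e 1 ≤ d 1)
    (hv : d (n + 1) = e (n + 2)) (hdn : d n = d (n + 1))
    (h : Sde n d (fun _ => 1) ≤ Sde n d e) :
    Sde (n + 1) d (fun _ => 1) ≤ Sde (n + 1) d e ∨ IsExceptional (n + 1) d e := by
  have hdn1 := hd (n + 1) (by omega) le_rfl
  have hmul := mul_le_mul_of_nonneg_left h (by linarith : 0 ≤ d (n + 1))
  suffices hs : ∑ i ∈ Icc 1 n, (d i - 1) + (d n - 1) ≤ Sde n d (fun _ => 1) ∨
      IsExceptional (n + 1) d e by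
    refine hs.imp_left fun hs => ?_
    rw [hdn] at hs
    rw [Sde_succ_of_eq hv, Sde_one_succ]
    nlinarith [mul_le_mul_of_nonneg_right hs (by linarith : 0 ≤ d (n + 1) - 1)]
  obtain rfl | ⟨m, rfl⟩ : n = 1 ∨ ∃ m, n = m + 2 := by
    rcases Nat.lt_or_ge n 2 with h2 | h2
    · exact Or.inl (by omega)
    · exact Or.inr ⟨n - 2, by omega⟩
  · rcases hdn1.eq_or_lt with h2 | h2
    · right
      norm_num at *
      have hd1 : d 1 = 2 := by linarith
      have he1 := he 1 (by omega) (by omega)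
      have he2 := he 2 (by omega) (by omega)
      have hS := h
      simp [Sde, prod_Icc_succ_top, hd1] at hS
      have e1 : e 1 = 1 := by
        by_contra hne
        have : e 1 = 2 := by omega
        simp [this] at hS
      have e2 : e 2 = 1 := by
        by_contra hne
        have : e 2 = 2 := by omega
        simp [this] at hS
      refine ⟨?_, by omega, e1, e2, fun i h1 h2 => ?_, fun j h1 h2 => ?_⟩
      · rw [Sde_succ_of_eq hv]
        simp [Sde, prod_Icc_succ_top, hd1, e1, e2, ← h2]
      · interval_cases i <;> omega
      · interval_cases j; omega
    · left
      norm_num at *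
      simp [Sde]
      nlinarith
  · left
    rw [Sde_one]
    exact sum_add_le_triSum m fun i h1 h2 => by linarith [hd i h1 (by omega)]

theorem Sde_one_le_or_isExceptional_succ {n : ℕ} {d e : ℕ → ℤ} (hdn : d n = d (n + 1))
    (hv : d (n + 1) = e (n + 2)) (h : IsExceptional n d e) :
    Sde (n + 1) d (fun _ => 1) ≤ Sde (n + 1) d e ∨ IsExceptional (n + 1) d e := by
  obtain ⟨hS, hn, he1, he2, hd, he⟩ := h
  have hd2 : d (n + 1) = 2 := by rw [← hdn]; exact hd n (by omega) le_rfl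
  have hS' : Sde (n + 1) d e = 2 ^ n := by
    rw [Sde_succ_of_eq hv, hS, hd2, ← pow_succ']
    congr 1
    omega
  have hd' : ∀ i, 1 ≤ i → i ≤ n + 1 → d i = 2 := fun i h1 h2 => by
    rcases Nat.lt_or_ge n i with hi | hi
    · obtain rfl : i = n + 1 := by omega
      exact hd2
    · exact hd i h1 hi
  by_cases h4 : n = 4
  · subst h4
    left
    have h1 := hd' 1 (by omega) (by omega)
    have h2 := hd' 2 (by omega) (by omega)
    have h3 := hd' 3 (by omega) (by omega)
    have h4 := hd' 4 (by omega) (by omega)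
    have h5 := hd' 5 (by omega) (by omega)
    rw [hS', Sde_one]
    simp [triSum_succ, triSum_zero, sum_Icc_succ_top, h1, h2, h3, h4, h5]
  · right
    refine ⟨hS', by omega, he1, he2, hd', fun j h1 h2 => ?_⟩
    rcases Nat.lt_or_ge (n + 1) j with hj | hj
    · obtain rfl : j = n + 2 := by omega
      rw [← hv, hd2]
    · exact he j h1 hj

theorem delOne_or_Sde_one_le_or_isExceptional (k : ℕ) (d e : ℕ → ℤ)
    (hepos : ∀ j, 1 ≤ j → j ≤ k + 1 → 1 ≤ e j)
    (hdmono : ∀ i j, 1 ≤ i → i ≤ j → j ≤ k → d i ≤ d j)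
    (hemono : ∀ i j, 1 ≤ i → i ≤ j → j ≤ k + 1 → e i ≤ e j)
    (hd1 : 2 ≤ d 1)
    (hC1 : CondOne k d e) (hC2 : CondTwo k d e) (hC3 : CondThree k d e) (n : ℕ) (hn : n ≤ k) :
    DelOne d e n ∨ Sde n d (fun _ => 1) ≤ Sde n d e ∨ IsExceptional n d e := by
  induction n with
  | zero => exact Or.inl (delOne_of_forall_eq fun j h1 h2 => by omega)
  | succ n ih =>
    have ih := ih (by omega)
    have hd2 : ∀ i, 1 ≤ i → i ≤ n + 1 → 2 ≤ d i := fun i h1 h2 =>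
      hd1.trans (hdmono 1 i le_rfl h1 (by omega))
    have hen : e (n + 1) ≤ e (n + 2) := hemono _ _ (by omega) (by omega) (by omega)
    rcases lt_trichotomy (d (n + 1)) (e (n + 2)) with hv | hv | hv
    · exact Or.inl (delOne_of_forall_eq (hC2 (n + 1) (by omega) hn hv))
    · by_cases hdel : DelOne d e n
      · exact Or.inl (hdel.succ hv)
      have hn1 : 1 ≤ n := by
        by_contra h0
        exact hdel (delOne_of_forall_eq fun j h1 h2 => by omega)
      have hdn : d n = d (n + 1) := by
        refine le_antisymm (hdmono _ _ hn1 (by omega) hn) ?_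
        rw [hv]
        by_contra! hlt
        exact hdel (hC3 n hn1 (by omega) hlt)
      rcases ih.resolve_left hdel with h | h
      · exact Or.inr (Sde_one_le_or_isExceptional_of_eq hn1 hd2
          (fun i h1 h2 => hepos i h1 (by omega)) hen (hC1 1 le_rfl (by omega)) hv hdn h)
      · exact Or.inr (Sde_one_le_or_isExceptional_succ hdn hv h)
    · have hnn : ∀ i ∈ Icc 1 (n + 1), 0 ≤ d i - e i := fun i hi => by
        rw [mem_Icc] at hi
        linarith [hC1 i hi.1 (by omega)]
      rcases (sum_nonneg hnn).eq_or_lt with hU | hU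
      · refine Or.inl (delOne_of_forall_eq fun j h1 h2 => ?_)
        have := (sum_eq_zero_iff_of_nonneg hnn).mp hU.symm j (mem_Icc.mpr ⟨h1, h2⟩)
        linarith
      · refine Or.inr (Or.inl ?_)
        rcases ih with h | h | h
        · exact Sde_one_le_of_delOne (fun i h1 h2 => by linarith [hd2 i h1 (by omega)])
            (fun i h1 h2 => hepos i h1 (by omega))
            (fun i h1 h2 => hdmono _ _ h1 h2 (by omega))
            (fun i j h1 h2 h3 => hemono _ _ h1 h2 (by omega)) hv hU h
        · exact Sde_one_le_of_lt (fun i h1 h2 => by linarith [hd2 i h1 h2])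
            (fun i h1 h2 => hepos i h1 (by omega))
            (fun i h1 h2 => hC1 i h1 (by omega)) hv hU h
        · exact Sde_one_le_of_isExceptional hen hv h

theorem stmt_0 (k : ℕ) (hk : 1 ≤ k) (d e : ℕ → ℤ)
    (hdpos : ∀ i, 1 ≤ i → i ≤ k → 1 ≤ d i)
    (hepos : ∀ j, 1 ≤ j → j ≤ k + 1 → 1 ≤ e j)
    (hdmono : ∀ i j, 1 ≤ i → i ≤ j → j ≤ k → d i ≤ d j)
    (hemono : ∀ i j, 1 ≤ i → i ≤ j → j ≤ k + 1 → e i ≤ e j)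
    (hd1 : 2 ≤ d 1)
    (hC1 : CondOne k d e) (hC2 : CondTwo k d e) (hC3 : CondThree k d e) :
    Sde k d e = 0 ∨
    (Sde k d (fun _ => 1) ≤ Sde k d e ∧
      Sde k d (fun _ => 1) =
        ∑ i ∈ Finset.Icc 1 k, ∑ j ∈ Finset.Icc i k, (d i - 1) * (d j - 1)) ∨
    (Sde k d e = 2 ^ (k - 1) ∧ (k = 2 ∨ k = 3 ∨ k = 4) ∧ e 1 = 1 ∧ e 2 = 1 ∧
      (∀ i, 1 ≤ i → i ≤ k → d i = 2) ∧ (∀ j, 3 ≤ j → j ≤ k + 1 → e j = 2)) := by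
  rcases delOne_or_Sde_one_le_or_isExceptional k d e hepos hdmono hemono hd1 hC1 hC2 hC3 k le_rfl
    with h | h | h
  · exact Or.inl (Sde_eq_zero_of_delOne h)
  · exact Or.inr (Or.inl ⟨h, Sde_one k d⟩)
  · exact Or.inr (Or.inr h)
end

section
/- Let k ≥ 1 and let d = (d_1,…,d_k) and e = (e_1,…,e_{k+1}) be non-decreasing sequences of positive integers satisfying conditions (C1) and (C2). Then for all 1 ≤ i ≤ j ≤ k the summand (d_i − e_i)(d_j − e_{j+1}) is non-negative; in particular S(d;e) ≥ 0. -/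
theorem stmt_1 (k : ℕ) (hk : 1 ≤ k) (d e : ℕ → ℤ)
    (hdpos : ∀ i, 1 ≤ i → i ≤ k → 1 ≤ d i)
    (hepos : ∀ j, 1 ≤ j → j ≤ k + 1 → 1 ≤ e j)
    (hdmono : ∀ i j, 1 ≤ i → i ≤ j → j ≤ k → d i ≤ d j)
    (hemono : ∀ i j, 1 ≤ i → i ≤ j → j ≤ k + 1 → e i ≤ e j)
    (hC1 : CondOne k d e) (hC2 : CondTwo k d e) :
    (∀ i j, 1 ≤ i → i ≤ j → j ≤ k → 0 ≤ (d i - e i) * (d j - e (j + 1))) ∧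
      0 ≤ Sde k d e := by
  have hterm : ∀ i j, 1 ≤ i → i ≤ j → j ≤ k → 0 ≤ (d i - e i) * (d j - e (j + 1)) := by
    intro i j hi hij hj
    rcases lt_or_ge (d j) (e (j + 1)) with hlt | hge
    · simp [hC2 j (hi.trans hij) hj hlt i hi hij]
    · exact mul_nonneg (sub_nonneg.2 (hC1 i hi (hij.trans hj))) (sub_nonneg.2 hge)
  refine ⟨hterm, mul_nonneg (Finset.prod_nonneg fun j hj => ?_)
    (Finset.sum_nonneg fun i hi => Finset.sum_nonneg fun j hj => ?_)⟩
  · rw [Finset.mem_Icc] at hj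
    exact zero_le_one.trans (hepos j hj.1 hj.2)
  · rw [Finset.mem_Icc] at hi hj
    exact hterm i j hi.1 hj.1 hj.2
end

section
/- Let k ≥ 1 and let d = (d_1,…,d_k) and e = (e_1,…,e_{k+1}) be non-decreasing sequences of positive integers satisfying conditions (C1) and (C2). Then S(d;e) = 0 if and only if d is a subsequence of e (i.e. d can be obtained from e by deleting one entry). -/
/-- Under (C1) and (C2) every summand of `S(d;e)` is nonnegative. -/
theorem summand_nonneg {k : ℕ} {d e : ℕ → ℤ} (hC1 : CondOne k d e) (hC2 : CondTwo k d e)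
    {i j : ℕ} (hi : 1 ≤ i) (hij : i ≤ j) (hj : j ≤ k) :
    0 ≤ (d i - e i) * (d j - e (j + 1)) := by
  rcases lt_or_ge (d j) (e (j + 1)) with h | h
  · simp [hC2 j (hi.trans hij) hj h i hi hij]
  · exact mul_nonneg (sub_nonneg.2 (hC1 i hi (hij.trans hj))) (sub_nonneg.2 h)

/-- Under (C1) and (C2), `S(d;e)` vanishes iff each of its summands does. -/
theorem Sde_eq_zero_iff {k : ℕ} {d e : ℕ → ℤ} (hepos : ∀ j, 1 ≤ j → j ≤ k + 1 → 1 ≤ e j)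
    (hC1 : CondOne k d e) (hC2 : CondTwo k d e) :
    Sde k d e = 0 ↔ ∀ i j, 1 ≤ i → i ≤ j → j ≤ k → d i = e i ∨ d j = e (j + 1) := by
  have hprod : ∏ j ∈ Finset.Icc 1 (k + 1), e j ≠ 0 := by
    refine Finset.prod_ne_zero_iff.2 fun j hj => ?_
    rw [Finset.mem_Icc] at hj
    have := hepos j hj.1 hj.2
    omega
  have hnonneg : ∀ i ∈ Finset.Icc 1 k, ∀ j ∈ Finset.Icc i k,
      0 ≤ (d i - e i) * (d j - e (j + 1)) := fun i hi j hj =>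
    summand_nonneg hC1 hC2 (Finset.mem_Icc.1 hi).1 (Finset.mem_Icc.1 hj).1 (Finset.mem_Icc.1 hj).2
  rw [Sde, mul_eq_zero, or_iff_right hprod,
    Finset.sum_eq_zero_iff_of_nonneg fun i hi => Finset.sum_nonneg (hnonneg i hi)]
  constructor
  · intro h i j hi hij hj
    have hi' : i ∈ Finset.Icc 1 k := Finset.mem_Icc.2 ⟨hi, hij.trans hj⟩
    have := (Finset.sum_eq_zero_iff_of_nonneg (hnonneg i hi')).1 (h i hi') j
      (Finset.mem_Icc.2 ⟨hij, hj⟩)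
    rwa [mul_eq_zero, sub_eq_zero, sub_eq_zero] at this
  · intro h i hi
    refine Finset.sum_eq_zero fun j hj => ?_
    rw [Finset.mem_Icc] at hi hj
    rw [mul_eq_zero, sub_eq_zero, sub_eq_zero]
    exact h i j hi.1 hj.1 hj.2

/-- `d` arises from `e` by deleting one entry iff for all `i ≤ j` either `d_i = e_i` or
`d_j = e_{j+1}`. -/
theorem delOne_iff {k : ℕ} {d e : ℕ → ℤ} :
    DelOne d e k ↔ ∀ i j, 1 ≤ i → i ≤ j → j ≤ k → d i = e i ∨ d j = e (j + 1) := by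
  classical
  constructor
  · rintro ⟨m, -, -, h⟩ i j hi hij hj
    rcases lt_or_ge i m with him | him
    · exact .inl (by simpa [him] using h i hi (hij.trans hj))
    · exact .inr (by simpa [(him.trans hij).not_gt] using h j (hi.trans hij) hj)
  · intro h
    by_cases hex : ∃ m, 1 ≤ m ∧ m ≤ k ∧ d m ≠ e m
    · obtain ⟨hm1, hmk, hm⟩ := Nat.find_spec hex
      refine ⟨Nat.find hex, hm1, hmk.trans k.le_succ, fun j hj hjk => ?_⟩
      split_ifs with hjm
      · by_contra hne
        exact Nat.find_min hex hjm ⟨hj, hjk, hne⟩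
      · exact (h _ j hm1 (not_lt.1 hjm) hjk).resolve_left hm
    · push Not at hex
      refine ⟨k + 1, k.succ_pos, le_rfl, fun j hj hjk => ?_⟩
      rw [if_pos (Nat.lt_succ_of_le hjk), hex j hj hjk]

theorem stmt_2 (k : ℕ) (hk : 1 ≤ k) (d e : ℕ → ℤ)
    (hdpos : ∀ i, 1 ≤ i → i ≤ k → 1 ≤ d i)
    (hepos : ∀ j, 1 ≤ j → j ≤ k + 1 → 1 ≤ e j)
    (hdmono : ∀ i j, 1 ≤ i → i ≤ j → j ≤ k → d i ≤ d j)
    (hemono : ∀ i j, 1 ≤ i → i ≤ j → j ≤ k + 1 → e i ≤ e j)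
    (hC1 : CondOne k d e) (hC2 : CondTwo k d e) :
    Sde k d e = 0 ↔ DelOne d e k := by
  rw [Sde_eq_zero_iff hepos hC1 hC2, delOne_iff]
end

section
/- Let k ≥ 1 and let d = (d_1,…,d_k) and e = (e_1,…,e_{k+1}) be non-decreasing sequences of positive integers such that d_i > e_{i+1} for every i = 1,…,k. Then S(d;e) ≥ S(d;1^{k+1}). -/
theorem mul_le_prod_of_one_le {ι : Type*} [DecidableEq ι] {s : Finset ι} {f : ι → ℤ}
    (hf : ∀ a ∈ s, 1 ≤ f a) {a b : ι} (ha : a ∈ s) (hb : b ∈ s) (hab : a ≠ b) :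
    f a * f b ≤ ∏ c ∈ s, f c := by
  have hrest : 1 ≤ ∏ c ∈ (s.erase a).erase b, f c :=
    Finset.prod_induction f (fun x => 1 ≤ x) (fun _ _ => one_le_mul_of_one_le_of_one_le) le_rfl
      fun c hc => hf c (Finset.mem_of_mem_erase (Finset.mem_of_mem_erase hc))
  rw [← Finset.mul_prod_erase s f ha,
    ← Finset.mul_prod_erase (s.erase a) f (Finset.mem_erase.2 ⟨hab.symm, hb⟩), ← mul_assoc]
  have h₁ := hf a ha
  have h₂ := hf b hb
  exact le_mul_of_one_le_right (by positivity) hrest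

theorem sub_one_le_mul_sub_s3 {x y : ℤ} (hx : 1 ≤ x) (hxy : x < y) : y - 1 ≤ x * (y - x) := by
  nlinarith [mul_nonneg (sub_nonneg.2 hx) (sub_nonneg.2 (Int.add_one_le_of_lt hxy))]

theorem stmt_3 (k : ℕ) (hk : 1 ≤ k) (d e : ℕ → ℤ)
    (hdpos : ∀ i, 1 ≤ i → i ≤ k → 1 ≤ d i)
    (hepos : ∀ j, 1 ≤ j → j ≤ k + 1 → 1 ≤ e j)
    (hdmono : ∀ i j, 1 ≤ i → i ≤ j → j ≤ k → d i ≤ d j)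
    (hemono : ∀ i j, 1 ≤ i → i ≤ j → j ≤ k + 1 → e i ≤ e j)
    (hgt : ∀ i, 1 ≤ i → i ≤ k → e (i + 1) < d i) :
    Sde k d (fun _ => 1) ≤ Sde k d e := by
  unfold Sde
  rw [Finset.prod_const_one, one_mul, Finset.mul_sum]
  refine Finset.sum_le_sum fun i hi => ?_
  rw [Finset.mul_sum]
  refine Finset.sum_le_sum fun j hj => ?_
  rw [Finset.mem_Icc] at hi hj
  have hi_lt : e i < d i :=
    (hemono i (i + 1) hi.1 (by omega) (by omega)).trans_lt (hgt i hi.1 hi.2)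
  have hj_lt : e (j + 1) < d j := hgt j (by omega) hj.2
  have hprod : e i * e (j + 1) ≤ ∏ c ∈ Finset.Icc 1 (k + 1), e c :=
    mul_le_prod_of_one_le
      (fun c hc => hepos c (Finset.mem_Icc.1 hc).1 (Finset.mem_Icc.1 hc).2)
      (Finset.mem_Icc.2 ⟨by omega, by omega⟩) (Finset.mem_Icc.2 ⟨by omega, by omega⟩) (by omega)
  have hei := hepos i hi.1 (by omega)
  have hej := hepos (j + 1) (by omega) (by omega)
  calc (d i - 1) * (d j - 1)
      ≤ (e i * (d i - e i)) * (e (j + 1) * (d j - e (j + 1))) :=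
        mul_le_mul (sub_one_le_mul_sub_s3 hei hi_lt) (sub_one_le_mul_sub_s3 hej hj_lt)
          (by linarith) (mul_nonneg (by linarith) (by linarith))
    _ = (e i * e (j + 1)) * ((d i - e i) * (d j - e (j + 1))) := by ring
    _ ≤ _ := mul_le_mul_of_nonneg_right hprod (mul_nonneg (by linarith) (by linarith))
end

section
/- Let k ≥ 1 and let d = (d_1,…,d_k) and e = (e_1,…,e_{k+1}) be non-decreasing sequences of positive integers such that d_1 > e_1 and d_i ≥ e_{i+1} for every i = 1,…,k. Then S(d;e) ≥ S(d; (1, e_2, …, e_{k+1})), i.e. replacing the first entry e_1 of e by 1 does not increase S. -/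
/-- `S(d;e)` with the dependence on the first entry `e 1` made explicit. -/
lemma Sde_eq_head (k : ℕ) (hk : 1 ≤ k) (d e : ℕ → ℤ) :
    Sde k d e = ((∏ j ∈ Finset.Ioc 1 (k + 1), e j) * e 1) *
      ((∑ i ∈ Finset.Ioc 1 k, ∑ j ∈ Finset.Icc i k, (d i - e i) * (d j - e (j + 1))) +
        (d 1 - e 1) * ∑ j ∈ Finset.Icc 1 k, (d j - e (j + 1))) := by
  rw [Sde, ← Finset.prod_Ioc_mul_eq_prod_Icc (by omega : 1 ≤ k + 1),
    ← Finset.sum_Ioc_add_eq_sum_Icc hk, Finset.mul_sum]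

theorem stmt_5 (k : ℕ) (hk : 1 ≤ k) (d e : ℕ → ℤ)
    (hdpos : ∀ i, 1 ≤ i → i ≤ k → 1 ≤ d i)
    (hepos : ∀ j, 1 ≤ j → j ≤ k + 1 → 1 ≤ e j)
    (hdmono : ∀ i j, 1 ≤ i → i ≤ j → j ≤ k → d i ≤ d j)
    (hemono : ∀ i j, 1 ≤ i → i ≤ j → j ≤ k + 1 → e i ≤ e j)
    (hd1 : e 1 < d 1)
    (hge : ∀ i, 1 ≤ i → i ≤ k → e (i + 1) ≤ d i) :
    Sde k d (fun j => if j = 1 then 1 else e j) ≤ Sde k d e := by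
  have hprod : ∏ j ∈ Finset.Ioc 1 (k + 1), (if j = 1 then 1 else e j) =
      ∏ j ∈ Finset.Ioc 1 (k + 1), e j :=
    Finset.prod_congr rfl fun j hj => if_neg (Finset.mem_Ioc.1 hj).1.ne'
  have hhead : ∑ j ∈ Finset.Icc 1 k, (d j - if j + 1 = 1 then 1 else e (j + 1)) =
      ∑ j ∈ Finset.Icc 1 k, (d j - e (j + 1)) :=
    Finset.sum_congr rfl fun j hj => by
      rw [if_neg (by have := (Finset.mem_Icc.1 hj).1; omega)]
  have htail : ∑ i ∈ Finset.Ioc 1 k, ∑ j ∈ Finset.Icc i k,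
        (d i - if i = 1 then 1 else e i) * (d j - if j + 1 = 1 then 1 else e (j + 1)) =
      ∑ i ∈ Finset.Ioc 1 k, ∑ j ∈ Finset.Icc i k, (d i - e i) * (d j - e (j + 1)) :=
    Finset.sum_congr rfl fun i hi => Finset.sum_congr rfl fun j hj => by
      have hi1 := (Finset.mem_Ioc.1 hi).1
      have hij := (Finset.mem_Icc.1 hj).1
      rw [if_neg (by omega), if_neg (by omega)]
  rw [Sde_eq_head k hk, Sde_eq_head k hk, hprod, hhead, htail, if_pos rfl]
  have hP : 0 ≤ ∏ j ∈ Finset.Ioc 1 (k + 1), e j := Finset.prod_nonneg fun j hj => by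
    have hj := Finset.mem_Ioc.1 hj
    linarith [hepos j hj.1.le hj.2]
  have hA : 0 ≤ ∑ j ∈ Finset.Icc 1 k, (d j - e (j + 1)) := Finset.sum_nonneg fun j hj => by
    have hj := Finset.mem_Icc.1 hj
    linarith [hge j hj.1 hj.2]
  have hB : 0 ≤ ∑ i ∈ Finset.Ioc 1 k, ∑ j ∈ Finset.Icc i k,
      (d i - e i) * (d j - e (j + 1)) :=
    Finset.sum_nonneg fun i hi => Finset.sum_nonneg fun j hj => by
      have hi := Finset.mem_Ioc.1 hi
      have hj := Finset.mem_Icc.1 hj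
      have hprev := hge (i - 1) (by omega) (by omega)
      rw [Nat.sub_add_cancel hi.1.le] at hprev
      have hmono := hdmono (i - 1) i (by omega) (by omega) hi.2
      have hlast := hge j (by omega) hj.2
      exact mul_nonneg (by linarith) (by linarith)
  have he := hepos 1 le_rfl (by omega)
  generalize ∏ j ∈ Finset.Ioc 1 (k + 1), e j = P at *
  generalize ∑ j ∈ Finset.Icc 1 k, (d j - e (j + 1)) = A at *
  generalize ∑ i ∈ Finset.Ioc 1 k, ∑ j ∈ Finset.Icc i k,
    (d i - e i) * (d j - e (j + 1)) = B at *
  have hgap : 0 ≤ P * ((e 1 - 1) * ((d 1 - e 1 - 1) * A + B)) :=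
    mul_nonneg hP (mul_nonneg (by linarith)
      (add_nonneg (mul_nonneg (by linarith [Int.add_one_le_iff.2 hd1]) hA) hB))
  linear_combination hgap
end

section
/- Let k ≥ 1 and let d_1,…,d_k and e_2,…,e_{k+1} be positive integers with d_1 ≤ d_2 ≤ … ≤ d_k, e_2 ≤ … ≤ e_{k+1}, and e_{j+1} ≤ d_j for every j = 1,…,k. If Σ_{j=1}^{k} (d_j − e_{j+1}) > 0, then e_2⋯e_{k+1} · (d_1 − 1) · Σ_{j=1}^{k} (d_j − e_{j+1}) ≥ (d_1 − 1) · (Σ_{j=1}^{k} d_j − k). -/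
theorem one_add_sum_sub_one_le_prod {ι : Type*} (s : Finset ι) (f : ι → ℤ)
    (hf : ∀ i ∈ s, 1 ≤ f i) : 1 + ∑ i ∈ s, (f i - 1) ≤ ∏ i ∈ s, f i := by
  classical
  induction s using Finset.induction_on with
  | empty => simp
  | insert a s ha ih =>
    rw [Finset.sum_insert ha, Finset.prod_insert ha]
    have h_one := hf a (Finset.mem_insert_self a s)
    have hs : ∀ i ∈ s, 1 ≤ f i := fun i hi => hf i (Finset.mem_insert_of_mem hi)
    have h_nonneg : 0 ≤ ∑ i ∈ s, (f i - 1) :=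
      Finset.sum_nonneg fun i hi => sub_nonneg.mpr (hs i hi)
    nlinarith [ih hs]

theorem stmt_7 (k : ℕ) (hk : 1 ≤ k) (d e : ℕ → ℤ)
    (hdpos : ∀ i, 1 ≤ i → i ≤ k → 1 ≤ d i)
    (hepos : ∀ j, 2 ≤ j → j ≤ k + 1 → 1 ≤ e j)
    (hdmono : ∀ i j, 1 ≤ i → i ≤ j → j ≤ k → d i ≤ d j)
    (hemono : ∀ i j, 2 ≤ i → i ≤ j → j ≤ k + 1 → e i ≤ e j)
    (hle : ∀ j, 1 ≤ j → j ≤ k → e (j + 1) ≤ d j)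
    (hsum : 0 < ∑ j ∈ Finset.Icc 1 k, (d j - e (j + 1))) :
    (d 1 - 1) * ((∑ j ∈ Finset.Icc 1 k, d j) - k) ≤
      (∏ j ∈ Finset.Icc 2 (k + 1), e j) * (d 1 - 1) *
        (∑ j ∈ Finset.Icc 1 k, (d j - e (j + 1))) := by
  have h_shift : ∏ j ∈ Finset.Icc 2 (k + 1), e j = ∏ j ∈ Finset.Icc 1 k, e (j + 1) := by
    rw [← Finset.prod_image (g := fun j => j + 1) (f := e) (fun a _ b _ h => by simpa using h),
      Finset.image_add_right_Icc]
  have he : ∀ j ∈ Finset.Icc 1 k, 1 ≤ e (j + 1) := fun j hj => by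
    rw [Finset.mem_Icc] at hj
    exact hepos (j + 1) (by omega) (by omega)
  have h_prod := one_add_sum_sub_one_le_prod (Finset.Icc 1 k) (fun j => e (j + 1)) he
  have h_nonneg : 0 ≤ ∑ j ∈ Finset.Icc 1 k, (e (j + 1) - 1) :=
    Finset.sum_nonneg fun j hj => sub_nonneg.mpr (he j hj)
  have h_split : (∑ j ∈ Finset.Icc 1 k, d j) - k =
      ∑ j ∈ Finset.Icc 1 k, (d j - e (j + 1)) + ∑ j ∈ Finset.Icc 1 k, (e (j + 1) - 1) := by
    simp [Finset.sum_sub_distrib]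
  rw [h_shift, h_split, mul_comm (∏ j ∈ Finset.Icc 1 k, e (j + 1)), mul_assoc]
  exact mul_le_mul_of_nonneg_left (by nlinarith) (sub_nonneg.mpr (hdpos 1 le_rfl hk))
end

section
/- Let k ≥ 1 and let d_1, e_1, e_2 be integers with d_1 ≥ 3 and 1 ≤ e_1 ≤ e_2 < d_1. Then S((d_1,…,d_1); (e_1, e_2, d_1, …, d_1)) ≥ d_1^{k−1}·(d_1 − 1)^2 ≥ C(k+1,2)·(d_1 − 1)^2 = S((d_1,…,d_1); 1^{k+1}), where (d_1,…,d_1) has length k, (e_1, e_2, d_1, …, d_1) has length k+1 (with k−1 entries equal to d_1), and C(k+1,2) = k(k+1)/2 is a binomial coefficient. -/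
theorem choose_two_le_three_pow (n : ℕ) : (n + 2).choose 2 ≤ 3 ^ n := by
  induction n with
  | zero => simp
  | succ n ih =>
    have h : (n + 3).choose 2 = (n + 2) + (n + 2).choose 2 := by
      rw [Nat.choose_succ_succ' (n + 2) 1, Nat.choose_one_right]
    have h' : (n + 2).choose 2 = (n + 1) + (n + 1).choose 2 := by
      rw [Nat.choose_succ_succ' (n + 1) 1, Nat.choose_one_right]
    rw [pow_succ]
    change (n + 3).choose 2 ≤ _
    omega

theorem Sde_const_of_eq_after_two (n : ℕ) (d a b : ℤ) :
    Sde (n + 1) (fun _ => d) (fun j => if j = 1 then a else if j = 2 then b else d) =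
      a * b * d ^ n * ((d - a) * (d - b)) := by
  have hprod : ∏ j ∈ Finset.Icc 1 (n + 1 + 1),
      (if j = 1 then a else if j = 2 then b else d) = a * b * d ^ n := by
    induction n with
    | zero => simp [Finset.prod_Icc_succ_top]
    | succ n ih =>
      rw [Finset.prod_Icc_succ_top (by omega), ih, if_neg (by omega), if_neg (by omega)]
      ring
  have hsum : ∑ i ∈ Finset.Icc 1 (n + 1), ∑ j ∈ Finset.Icc i (n + 1),
      (d - (if i = 1 then a else if i = 2 then b else d)) *
        (d - (if j + 1 = 1 then a else if j + 1 = 2 then b else d)) = (d - a) * (d - b) := by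
    rw [Finset.sum_eq_single_of_mem 1 (by simp), Finset.sum_eq_single_of_mem 1 (by simp)]
    · simp
    · intro j hj hj1
      rw [Finset.mem_Icc] at hj
      rw [if_neg (by omega : ¬ j + 1 = 1), if_neg (by omega : ¬ j + 1 = 2)]
      simp
    · intro i hi hi1
      rw [Finset.mem_Icc] at hi
      refine Finset.sum_eq_zero fun j hj => ?_
      rw [Finset.mem_Icc] at hj
      rw [if_neg (by omega : ¬ j + 1 = 1), if_neg (by omega : ¬ j + 1 = 2)]
      simp
  simp only [Sde]
  rw [hprod, hsum]

theorem sum_Icc_sum_Icc_const (k : ℕ) (c : ℤ) :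
    ∑ i ∈ Finset.Icc 1 k, ∑ _j ∈ Finset.Icc i k, c = ((k + 1).choose 2 : ℤ) * c := by
  induction k with
  | zero => simp
  | succ k ih =>
    have h : ∀ i ∈ Finset.Icc 1 (k + 1),
        ∑ _j ∈ Finset.Icc i (k + 1), c = ∑ _j ∈ Finset.Icc i k, c + c := by
      intro i hi
      exact Finset.sum_Icc_succ_top (Finset.mem_Icc.mp hi).2 _
    rw [Finset.sum_congr rfl h, Finset.sum_add_distrib, Finset.sum_Icc_succ_top (by omega), ih,
      Nat.choose_succ_succ' (k + 1) 1, Nat.choose_one_right]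
    simp
    ring

theorem stmt_8 (k : ℕ) (hk : 1 ≤ k) (d₁ e₁ e₂ : ℤ)
    (hd : 3 ≤ d₁) (h1 : 1 ≤ e₁) (h12 : e₁ ≤ e₂) (h2 : e₂ < d₁) :
    d₁ ^ (k - 1) * (d₁ - 1) ^ 2 ≤
        Sde k (fun _ => d₁) (fun j => if j = 1 then e₁ else if j = 2 then e₂ else d₁) ∧
      ((k + 1).choose 2 : ℤ) * (d₁ - 1) ^ 2 ≤ d₁ ^ (k - 1) * (d₁ - 1) ^ 2 ∧
      ((k + 1).choose 2 : ℤ) * (d₁ - 1) ^ 2 = Sde k (fun _ => d₁) (fun _ => 1) := by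
  refine ⟨?_, ?_, ?_⟩
  · obtain ⟨n, rfl⟩ := Nat.exists_eq_add_of_le' hk
    rw [Sde_const_of_eq_after_two, Nat.add_sub_cancel]
    have he₁ : d₁ - 1 ≤ e₁ * (d₁ - e₁) := by
      nlinarith [mul_nonneg (sub_nonneg.2 h1) (by linarith : 0 ≤ d₁ - 1 - e₁)]
    have he₂ : d₁ - 1 ≤ e₂ * (d₁ - e₂) := by
      nlinarith [mul_nonneg (by linarith : 0 ≤ e₂ - 1) (by linarith : 0 ≤ d₁ - 1 - e₂)]
    calc d₁ ^ n * (d₁ - 1) ^ 2 = d₁ ^ n * ((d₁ - 1) * (d₁ - 1)) := by ring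
      _ ≤ d₁ ^ n * ((e₁ * (d₁ - e₁)) * (e₂ * (d₁ - e₂))) :=
        mul_le_mul_of_nonneg_left (mul_le_mul he₁ he₂ (by linarith) (by linarith))
          (pow_nonneg (by linarith) n)
      _ = _ := by ring
  · obtain ⟨n, rfl⟩ := Nat.exists_eq_add_of_le' hk
    rw [Nat.add_sub_cancel]
    refine mul_le_mul_of_nonneg_right ?_ (sq_nonneg _)
    calc ((n + 1 + 1).choose 2 : ℤ) ≤ 3 ^ n := by exact_mod_cast choose_two_le_three_pow n
      _ ≤ d₁ ^ n := pow_le_pow_left₀ (by norm_num) hd n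
  · simp only [Sde, Finset.prod_const_one, one_mul]
    rw [sum_Icc_sum_Icc_const]
    ring
end

section
/- Let k ≥ 2 and let d = (d_1,…,d_k) and e = (e_1,…,e_{k+1}) be non-decreasing sequences of positive integers satisfying conditions (C1), (C2), (C3). Assume d_1 > e_1 and that (d_2,…,d_k) is a subsequence of (e_2,…,e_{k+1}). Then either d is a subsequence of e, or d_1 = d_2 = … = d_k = e_3 = … = e_{k+1} and e_2 < d_1. -/
theorem stmt_10 (k : ℕ) (hk : 2 ≤ k) (d e : ℕ → ℤ)
    (hdpos : ∀ i, 1 ≤ i → i ≤ k → 1 ≤ d i)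
    (hepos : ∀ j, 1 ≤ j → j ≤ k + 1 → 1 ≤ e j)
    (hdmono : ∀ i j, 1 ≤ i → i ≤ j → j ≤ k → d i ≤ d j)
    (hemono : ∀ i j, 1 ≤ i → i ≤ j → j ≤ k + 1 → e i ≤ e j)
    (hC1 : CondOne k d e) (hC2 : CondTwo k d e) (hC3 : CondThree k d e)
    (hd1 : e 1 < d 1)
    (hsub : DelOne (fun j => d (j + 1)) (fun j => e (j + 1)) (k - 1)) :
    DelOne d e k ∨
      ((∀ i, 1 ≤ i → i ≤ k → d i = d 1) ∧
        (∀ j, 3 ≤ j → j ≤ k + 1 → e j = d 1) ∧ e 2 < d 1) := by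
  obtain ⟨m, hm1, hmk, hm⟩ := hsub
  have hshift : ∀ i, 1 ≤ i → i ≤ k → e (i + 1) ≤ d i := by
    intro i hi hik
    by_contra! h
    exact hd1.ne' (hC2 i hi hik h 1 le_rfl hi)
  have htail : ∀ i, 2 ≤ i → i ≤ k → d i = e (i + 1) := by
    intro i hi hik
    have h := hm (i - 1) (by omega) (by omega)
    simp only [Nat.sub_add_cancel (show 1 ≤ i by omega)] at h
    split_ifs at h with hlt
    · have h1 := hshift i (by omega) hik
      have h2 := hemono i (i + 1) (by omega) (by omega) (by omega)
      omega
    · exact h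
  rcases (hshift 1 le_rfl (by omega)).eq_or_lt with heq | hlt
  · refine Or.inl ⟨1, le_rfl, by omega, fun j hj hjk => ?_⟩
    rw [if_neg (by omega)]
    rcases hj.eq_or_lt with rfl | hj'
    · exact heq.symm
    · exact htail j hj' hjk
  · right
    have hshift' : ∀ i, 1 ≤ i → i ≤ k - 1 → e (i + 2) ≤ d i := by
      intro i hi hik
      by_contra! h
      obtain ⟨n, -, -, hn⟩ := hC3 i hi hik h
      have h1 := hn 1 le_rfl hi
      split_ifs at h1
      · exact hd1.ne' h1
      · exact hlt.ne' h1
    have he : ∀ j, 3 ≤ j → j ≤ k + 1 → e j = d 1 := by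
      intro j hj
      induction j, hj using Nat.le_induction with
      | base =>
        intro _
        exact le_antisymm (hshift' 1 le_rfl (by omega))
          ((hdmono 1 2 le_rfl (by omega) hk).trans_eq (htail 2 le_rfl hk))
      | succ j hj ih =>
        intro hjk
        obtain ⟨i, rfl⟩ : ∃ i, j = i + 1 := ⟨j - 1, by omega⟩
        have h1 := ih (by omega)
        have h2 := hshift' i (by omega) (by omega)
        have h3 := htail i (by omega) (by omega)
        have h4 := hemono (i + 1) (i + 2) (by omega) (by omega) hjk
        exact le_antisymm (h2.trans_eq (h3.trans h1)) (h1.symm.trans_le h4)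
    refine ⟨fun i hi hik => ?_, he, hlt⟩
    rcases hi.eq_or_lt with rfl | hi'
    · rfl
    · rw [htail i hi' hik, he (i + 1) (by omega) (by omega)]
end

section
/- Let k ≥ 1 and let f_1,…,f_k and g_1,…,g_{k+1} be nonzero homogeneous polynomials in ℂ[x_0,…,x_{k+3}] of positive degrees, with deg f_1 ≤ … ≤ deg f_k and deg g_1 ≤ … ≤ deg g_{k+1}. Assume that the ideal ⟨f_1,…,f_k⟩ is contained in the ideal ⟨g_1,…,g_{k+1}⟩, and that the projective variety X = V(f_1,…,f_k) ⊂ P^{k+3}(ℂ) has dimension 3 (i.e. the Krull dimension of ℂ[x_0,…,x_{k+3}]/⟨f_1,…,f_k⟩ equals 4). Then deg f_j ≥ deg g_j for every j = 1,…,k. -/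
namespace MvPolynomial

/-- The endomorphism of `R[X₀, …, Xₙ₋₁]` sending the first `i` variables to zero. -/
noncomputable def killInitial (R : Type*) [CommRing R] (n i : ℕ) :
    MvPolynomial (Fin n) R →ₐ[R] MvPolynomial (Fin n) R :=
  aeval fun j => if j.val < i then 0 else X j

theorem killInitial_comp_of_le (R : Type*) [CommRing R] (n : ℕ) {i i' : ℕ} (h : i ≤ i') :
    (killInitial R n i').comp (killInitial R n i) = killInitial R n i' := by
  ext1 j
  by_cases hj : j.val < i
  · simp [killInitial, hj, hj.trans_le h]
  · simp [killInitial, hj]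

theorem ker_killInitial_lt_succ (R : Type*) [CommRing R] [Nontrivial R] {n i : ℕ} (hi : i < n) :
    RingHom.ker (killInitial R n i) < RingHom.ker (killInitial R n (i + 1)) := by
  refine lt_of_le_of_ne (fun p hp => ?_) fun h => ?_
  · rw [RingHom.mem_ker] at hp ⊢
    rw [← killInitial_comp_of_le R n i.le_succ, AlgHom.comp_apply, hp, map_zero]
  · have hX : (X ⟨i, hi⟩ : MvPolynomial (Fin n) R) ∈ RingHom.ker (killInitial R n (i + 1)) := by
      simp [RingHom.mem_ker, killInitial]
    rw [← h] at hX
    simp [RingHom.mem_ker, killInitial] at hX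

theorem le_height_ker_killInitial (R : Type*) [CommRing R] [IsDomain R] {n i : ℕ} (hi : i ≤ n) :
    (i : ℕ∞) ≤ (RingHom.ker (killInitial R n i)).height := by
  induction i with
  | zero => simp
  | succ i ih =>
    have hprime (m : ℕ) : (RingHom.ker (killInitial R n m)).IsPrime := RingHom.ker_isPrime _
    have := hprime i
    have := hprime (i + 1)
    calc ((i + 1 : ℕ) : ℕ∞) = (i : ℕ∞) + 1 := by push_cast; rfl
      _ ≤ (RingHom.ker (killInitial R n i)).height + 1 := by gcongr; exact ih (by omega)
      _ ≤ _ := Ideal.height_add_one_le_of_lt_of_isPrime (ker_killInitial_lt_succ R (by omega))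

theorem IsHomogeneous.mem_ker_killInitial {R : Type*} [CommRing R] {n d : ℕ}
    {p : MvPolynomial (Fin n) R} (hp : p.IsHomogeneous d) (hd : 0 < d) :
    p ∈ RingHom.ker (killInitial R n n) := by
  have h0 : (fun j : Fin n => if j.val < n then (0 : MvPolynomial (Fin n) R) else X j) = 0 := by
    ext1 j
    simp
  rw [RingHom.mem_ker, killInitial, h0, aeval_zero, constantCoeff_eq,
    hp.coeff_eq_zero (by simpa using hd.ne), map_zero]

/-- Polynomials without constant term cut the dimension of affine space by at most their number. -/
theorem card_le_ringKrullDim_quotient_span_add_encard {R : Type*} [CommRing R] [IsDomain R]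
    [IsNoetherianRing R] {n : ℕ} (s : Set (MvPolynomial (Fin n) R))
    (hs : s ⊆ RingHom.ker (killInitial R n n)) :
    (n : WithBot ℕ∞) ≤ ringKrullDim (MvPolynomial (Fin n) R ⧸ Ideal.span s) + s.encard := by
  have : (RingHom.ker (killInitial R n n)).IsPrime := RingHom.ker_isPrime _
  refine le_trans ?_ (Ideal.height_le_ringKrullDim_quotient_add_encard s hs)
  exact_mod_cast le_height_ker_killInitial R le_rfl

/-- The degree `d` part of a multiple of a homogeneous polynomial `q` of degree `e` is a multiple
of `q`, and vanishes if `d < e`. -/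
theorem homogeneousComponent_mul_of_isHomogeneous {σ R : Type*} [CommRing R]
    (a : MvPolynomial σ R) {q : MvPolynomial σ R} {e : ℕ} (hq : q.IsHomogeneous e) (d : ℕ) :
    homogeneousComponent d (a * q) =
      if e ≤ d then homogeneousComponent (d - e) a * q else 0 := by
  have key (i : ℕ) : homogeneousComponent d (homogeneousComponent i a * q) =
      if d = i + e then homogeneousComponent i a * q else 0 :=
    homogeneousComponent_of_mem <| (mem_homogeneousSubmodule _ _).mpr <|
      (homogeneousComponent_isHomogeneous i a).mul hq
  conv_lhs => rw [← sum_homogeneousComponent a, Finset.sum_mul, map_sum]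
  simp_rw [key]
  split_ifs with h
  · have hiff (i : ℕ) : d = i + e ↔ d - e = i := by omega
    simp_rw [hiff]
    rw [Finset.sum_ite_eq]
    split_ifs with hmem
    · rfl
    · rw [homogeneousComponent_eq_zero _ _ (by rw [Finset.mem_range] at hmem; omega), zero_mul]
  · exact Finset.sum_eq_zero fun i _ => if_neg (by omega)

theorem IsHomogeneous.mem_span_image_of_degree_le {σ ι R : Type*} [CommRing R]
    {g : ι → MvPolynomial σ R} {dg : ι → ℕ} {s : Set ι}
    (hg : ∀ i ∈ s, (g i).IsHomogeneous (dg i)) {p : MvPolynomial σ R} {d : ℕ}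
    (hp : p.IsHomogeneous d) (hps : p ∈ Ideal.span (g '' s)) :
    p ∈ Ideal.span (g '' {i ∈ s | dg i ≤ d}) := by
  obtain ⟨t, hts, c, rfl⟩ := (Submodule.mem_span_image_iff_exists_fun _).mp hps
  have hself := homogeneousComponent_of_mem (m := d) hp
  rw [if_pos rfl] at hself
  rw [← hself, map_sum]
  refine Ideal.sum_mem _ fun i _ => ?_
  have hi : (i : ι) ∈ s := hts i.2
  rw [smul_eq_mul, homogeneousComponent_mul_of_isHomogeneous _ (hg i hi)]
  split_ifs with h
  · exact Ideal.mul_mem_left _ _ (Ideal.subset_span ⟨i, ⟨hi, h⟩, rfl⟩)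
  · exact zero_mem _

end MvPolynomial

theorem stmt_11 (k : ℕ) (hk : 1 ≤ k)
    (f g : ℕ → MvPolynomial (Fin (k + 4)) ℂ) (df dg : ℕ → ℕ)
    (hf0 : ∀ i, 1 ≤ i → i ≤ k → f i ≠ 0)
    (hg0 : ∀ j, 1 ≤ j → j ≤ k + 1 → g j ≠ 0)
    (hfh : ∀ i, 1 ≤ i → i ≤ k → (f i).IsHomogeneous (df i))
    (hgh : ∀ j, 1 ≤ j → j ≤ k + 1 → (g j).IsHomogeneous (dg j))
    (hdfpos : ∀ i, 1 ≤ i → i ≤ k → 0 < df i)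
    (hdgpos : ∀ j, 1 ≤ j → j ≤ k + 1 → 0 < dg j)
    (hdfmono : ∀ i j, 1 ≤ i → i ≤ j → j ≤ k → df i ≤ df j)
    (hdgmono : ∀ i j, 1 ≤ i → i ≤ j → j ≤ k + 1 → dg i ≤ dg j)
    (hsub : Ideal.span (f '' Set.Icc 1 k) ≤ Ideal.span (g '' Set.Icc 1 (k + 1)))
    (hdim : ringKrullDim
        (MvPolynomial (Fin (k + 4)) ℂ ⧸ Ideal.span (f '' Set.Icc 1 k)) = 4) :
    ∀ j, 1 ≤ j → j ≤ k → dg j ≤ df j := by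
  intro j hj1 hjk
  by_contra! hlt
  set s : Set (MvPolynomial (Fin (k + 4)) ℂ) :=
    g '' Set.Icc 1 (j - 1) ∪ f '' Set.Icc (j + 1) k with hs
  have hs_ker : s ⊆ RingHom.ker (MvPolynomial.killInitial ℂ (k + 4) (k + 4)) := by
    rintro _ (⟨i, ⟨hi1, hi2⟩, rfl⟩ | ⟨i, ⟨hi1, hi2⟩, rfl⟩)
    · exact (hgh i hi1 (by omega)).mem_ker_killInitial (hdgpos i hi1 (by omega))
    · exact (hfh i (by omega) hi2).mem_ker_killInitial (hdfpos i (by omega) hi2)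
  have hfs : Ideal.span (f '' Set.Icc 1 k) ≤ Ideal.span s := by
    rw [Ideal.span_le]
    rintro _ ⟨i, ⟨hi1, hik⟩, rfl⟩
    rcases le_or_gt i j with hij | hij
    · have hmem := (hfh i hi1 hik).mem_span_image_of_degree_le
        (fun l (hl : l ∈ Set.Icc 1 (k + 1)) => hgh l hl.1 hl.2)
        (hsub (Ideal.subset_span ⟨i, ⟨hi1, hik⟩, rfl⟩))
      refine Ideal.span_mono ?_ hmem
      rintro _ ⟨l, ⟨⟨hl1, hlk⟩, hl⟩, rfl⟩
      refine Or.inl ⟨l, ⟨hl1, ?_⟩, rfl⟩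
      by_contra! hjl
      have := hdgmono j l hj1 (by omega) hlk
      have := hdfmono i j hi1 hij hjk
      omega
    · exact Ideal.subset_span (Or.inr ⟨i, ⟨hij, hik⟩, rfl⟩)
  have hcard : s.encard ≤ (k - 1 : ℕ) := by
    have hIcc (a b : ℕ) : (Set.Icc a b).encard = (b + 1 - a : ℕ) := by
      rw [← Finset.coe_Icc, Set.encard_coe_eq_coe_finsetCard, Nat.card_Icc]
    calc s.encard ≤ (g '' Set.Icc 1 (j - 1)).encard + (f '' Set.Icc (j + 1) k).encard :=
          Set.encard_union_le _ _
      _ ≤ (Set.Icc 1 (j - 1)).encard + (Set.Icc (j + 1) k).encard :=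
          add_le_add (Set.encard_image_le _ _) (Set.encard_image_le _ _)
      _ = (k - 1 : ℕ) := by
          rw [hIcc, hIcc, ← Nat.cast_add]
          congr 1
          omega
  have hdim_le := ringKrullDim_le_of_surjective _ (Ideal.Quotient.factor_surjective hfs)
  rw [hdim] at hdim_le
  have hle : ((k + 4 : ℕ) : WithBot ℕ∞) ≤ ((4 + (k - 1) : ℕ) : WithBot ℕ∞) := by
    rw [Nat.cast_add 4]
    exact (MvPolynomial.card_le_ringKrullDim_quotient_span_add_encard s hs_ker).trans
      (add_le_add hdim_le (WithBot.coe_le_coe.mpr hcard))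
  have := Nat.cast_le.mp hle
  omega
end
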